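/- arXiv:1506.06186 — 2 statements merged into one kernel-verified Lean document; each statement's English description precedes it below -/
import Mathlib

section
/- For every integer k ≥ 1, the maximum of the sizes of all simultaneous (2k−1, 2k, 2k+1)-core partitions equals k·C(k+1, 3) = k²(k+1)(k−1)/6, where C(k+1,3) denotes the binomial coefficient. -/
/-- The hook length of the cell `(i, j)` (0-indexed) of a Young diagram. -/
def YoungDiagram.hookLength (Y : YoungDiagram) (i j : ℕ) : ℕ :=
  Y.rowLen i - j + (Y.colLen j - i) - 1

/-- A Young diagram (partition) is a `t`-core if no cell has hook length `t`. -/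
def YoungDiagram.IsCore (Y : YoungDiagram) (t : ℕ) : Prop :=
  ∀ c ∈ Y.cells, Y.hookLength c.1 c.2 ≠ t

namespace YoungDiagram

theorem card_eq_sum_rowLen (Y : YoungDiagram) :
    Y.card = ∑ i ∈ Finset.range (Y.colLen 0), Y.rowLen i := by
  have hmaps : ∀ c ∈ Y.cells, c.1 ∈ Finset.range (Y.colLen 0) := fun c hc =>
    Finset.mem_range.2 (mem_iff_lt_colLen.1 (Y.up_left_mem le_rfl (Nat.zero_le c.2) hc))
  rw [YoungDiagram.card, Finset.card_eq_sum_card_fiberwise hmaps]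
  exact Finset.sum_congr rfl fun i _ => (Y.rowLen_eq_card).symm

/-- The set of hook lengths in the first column of a Young diagram. -/
def betaSet_s2 (Y : YoungDiagram) : Finset ℕ :=
  (Finset.range (Y.colLen 0)).image fun i => Y.hookLength i 0

theorem hookLength_zero_lt (Y : YoungDiagram) {i j : ℕ} (hij : i < j) (hj : j < Y.colLen 0) :
    Y.hookLength j 0 < Y.hookLength i 0 := by
  have := Y.rowLen_anti i j hij.le
  unfold hookLength
  omega

theorem hookLength_zero_injOn (Y : YoungDiagram) :
    Set.InjOn (fun i => Y.hookLength i 0) (Finset.range (Y.colLen 0)) := by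
  intro i hi j hj h
  simp only [Finset.coe_range, Set.mem_Iio] at hi hj h
  rcases lt_trichotomy i j with hij | hij | hij
  · exact absurd h (Y.hookLength_zero_lt hij hj).ne'
  · exact hij
  · exact absurd h (Y.hookLength_zero_lt hij hi).ne

theorem card_betaSet (Y : YoungDiagram) : Y.betaSet_s2.card = Y.colLen 0 := by
  rw [betaSet_s2, Finset.card_image_of_injOn Y.hookLength_zero_injOn, Finset.card_range]

theorem two_mul_sum_betaSet (Y : YoungDiagram) :
    2 * ∑ x ∈ Y.betaSet_s2, x = 2 * Y.card + Y.betaSet_s2.card * (Y.betaSet_s2.card - 1) := by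
  have h : ∑ x ∈ Y.betaSet_s2, x
      = ∑ i ∈ Finset.range (Y.colLen 0), (Y.rowLen i + (Y.colLen 0 - 1 - i)) := by
    rw [betaSet_s2, Finset.sum_image Y.hookLength_zero_injOn]
    refine Finset.sum_congr rfl fun i hi => ?_
    have := Finset.mem_range.1 hi
    unfold hookLength
    omega
  rw [h, Finset.sum_add_distrib, ← card_eq_sum_rowLen, Finset.sum_range_reflect (fun i => i),
    card_betaSet, mul_add, mul_comm 2 (∑ i ∈ _, i), Finset.sum_range_id_mul_two]

theorem zero_notMem_betaSet (Y : YoungDiagram) : 0 ∉ Y.betaSet_s2 := by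
  simp only [betaSet_s2, Finset.mem_image, Finset.mem_range, not_exists, not_and]
  intro i hi
  have := mem_iff_lt_rowLen.1 (mem_iff_lt_colLen.2 hi)
  unfold hookLength
  omega

theorem IsCore.sub_mem_betaSet {Y : YoungDiagram} {t x : ℕ} (hY : Y.IsCore t) (ht : 0 < t)
    (hx : x ∈ Y.betaSet_s2) (htx : t ≤ x) : x - t ∈ Y.betaSet_s2 := by
  by_contra hy
  obtain ⟨i, hi, rfl⟩ := Finset.mem_image.1 hx
  rw [Finset.mem_range] at hi
  set m := Y.colLen 0 with hm
  set y := Y.hookLength i 0 - t with hydef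
  have hne : ∀ r < m, Y.hookLength r 0 ≠ y := fun r hr h =>
    hy (Finset.mem_image.2 ⟨r, Finset.mem_range.2 hr, h⟩)
  have hex : ∃ r, ¬ (r < m ∧ y < Y.hookLength r 0) := ⟨m, fun h => h.1.false⟩
  obtain ⟨r, hr, hmin⟩ : ∃ r, ¬ (r < m ∧ y < Y.hookLength r 0) ∧
      ∀ s < r, s < m ∧ y < Y.hookLength s 0 :=
    ⟨Nat.find hex, Nat.find_spec hex, fun s hs => not_not.1 (Nat.find_min hex hs)⟩
  have hir : i < r := by
    by_contra! h
    refine hr ⟨by omega, ?_⟩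
    rcases h.eq_or_lt with rfl | h
    · omega
    · have := Y.hookLength_zero_lt h hi
      omega
  obtain ⟨hrm, hry⟩ := hmin (r - 1) (by omega)
  have hrow : y + r - m < Y.rowLen (r - 1) ∧ m ≤ y + r ∧ Y.rowLen r ≤ y + r - m := by
    by_cases h : r < m
    · have h1 := hne r h
      have h2 : ¬ y < Y.hookLength r 0 := fun h' => hr ⟨h, h'⟩
      have h3 := mem_iff_lt_rowLen.1 (mem_iff_lt_colLen.2 h)
      unfold hookLength at hry h1 h2
      omega
    · have h3 : ¬ 0 < Y.rowLen r := fun h' =>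
        h (mem_iff_lt_colLen.1 (mem_iff_lt_rowLen.2 h'))
      unfold hookLength at hry
      omega
  obtain ⟨h1, h2, h3⟩ := hrow
  have hcol : Y.colLen (y + r - m) = r := by
    have h4 := mem_iff_lt_colLen.1 (mem_iff_lt_rowLen.2 h1)
    have h5 : ¬ r < Y.colLen (y + r - m) := fun h' =>
      absurd (mem_iff_lt_rowLen.1 (mem_iff_lt_colLen.2 h')) (by omega)
    omega
  have h6 := Y.rowLen_anti i (r - 1) (by omega)
  refine hY (i, y + r - m) (mem_iff_lt_rowLen.2 (by omega)) ?_
  simp only [hookLength, hcol] at hydef htx ⊢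
  omega

end YoungDiagram

theorem mul_sub_le_sum_mul_centered {s : ℕ → ℤ} {n : ℕ} (hs : MonotoneOn s (Set.Iic n)) :
    (n : ℤ) * (s n - s 0) ≤ ∑ j ∈ Finset.range (n + 1), s j * (2 * j - n) := by
  induction n with
  | zero => simp
  | succ n ih =>
    have ih := ih (hs.mono (Set.Iic_subset_Iic.2 n.le_succ))
    have hsum : ∑ j ∈ Finset.range (n + 1), s j ≤ n * s n + s 0 := by
      rw [Finset.sum_range_succ']
      have := Finset.sum_le_card_nsmul (Finset.range n) (fun j => s (j + 1)) (s n) fun j hj => by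
        have := Finset.mem_range.1 hj
        exact hs (Set.mem_Iic.2 (by omega)) (Set.mem_Iic.2 (by omega)) (by omega)
      simpa using this
    have hsplit : ∑ j ∈ Finset.range (n + 1), s j * (2 * j - ((n + 1 : ℕ) : ℤ))
        = ∑ j ∈ Finset.range (n + 1), s j * (2 * j - n) - ∑ j ∈ Finset.range (n + 1), s j := by
      rw [← Finset.sum_sub_distrib]
      refine Finset.sum_congr rfl fun j _ => ?_
      push_cast
      ring
    rw [Finset.sum_range_succ, hsplit]
    push_cast
    linarith

theorem centered_quadratic_nonneg {s : ℕ → ℤ} {n : ℕ} (hs : MonotoneOn s (Set.Iic n)) {c : ℤ}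
    (hc : n + 2 ≤ c) :
    0 ≤ c * ∑ j ∈ Finset.range (n + 1), s j * (2 * j - n)
      + ∑ j ∈ Finset.range (n + 1), s j ^ 2 - ∑ j ∈ Finset.range (n + 1), s j
      + (∑ j ∈ Finset.range (n + 1), s j) * (∑ j ∈ Finset.range (n + 1), s j - (n + 1)) := by
  have hC := mul_sub_le_sum_mul_centered hs
  have h0n : s 0 ≤ s n := hs (Set.mem_Iic.2 n.zero_le) (Set.mem_Iic.2 le_rfl) n.zero_le
  have hQ : ∑ j ∈ Finset.range (n + 1), s j ≤ ∑ j ∈ Finset.range (n + 1), s j ^ 2 :=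
    Finset.sum_le_sum fun j _ => Int.le_self_sq (s j)
  have hlow : ((n + 1 : ℕ) : ℤ) * s 0 ≤ ∑ j ∈ Finset.range (n + 1), s j := by
    have := Finset.card_nsmul_le_sum (Finset.range (n + 1)) s (s 0) fun j hj =>
      hs (Set.mem_Iic.2 n.zero_le) (Set.mem_Iic.2 (by have := Finset.mem_range.1 hj; omega))
        j.zero_le
    simpa using this
  have hupp : ∑ j ∈ Finset.range (n + 1), s j ≤ ((n + 1 : ℕ) : ℤ) * s n := by
    have := Finset.sum_le_card_nsmul (Finset.range (n + 1)) s (s n) fun j hj => by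
      have := Finset.mem_range.1 hj
      exact hs (Set.mem_Iic.2 (by omega)) (Set.mem_Iic.2 le_rfl) (by omega)
    simpa using this
  push_cast at hlow hupp
  generalize ∑ j ∈ Finset.range (n + 1), s j * (2 * j - (n : ℤ)) = C at *
  generalize ∑ j ∈ Finset.range (n + 1), s j = S at *
  have hC0 : 0 ≤ C := le_trans (mul_nonneg (by positivity) (by linarith)) hC
  have hcC : 0 ≤ c * C := mul_nonneg (by linarith) hC0
  by_cases hS : 0 < S ∧ S < n + 1
  · have h0 : s 0 ≤ 0 := by
      by_contra! h
      nlinarith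
    have h1 : 1 ≤ s n := by
      by_contra! h
      nlinarith
    have hCn : (n : ℤ) ≤ C := by nlinarith
    have : (n + 2 : ℤ) * n ≤ c * C :=
      mul_le_mul hc hCn (by positivity) (by linarith)
    nlinarith
  · have : 0 ≤ S * (S - (n + 1)) := by
      rcases not_and_or.1 hS with h | h
      · exact mul_nonneg_of_nonpos_of_nonpos (by linarith) (by linarith)
      · exact mul_nonneg (by linarith) (by linarith)
    linarith

theorem sum_range_cast_mul_two (n : ℕ) :
    2 * ∑ j ∈ Finset.range n, (j : ℤ) = n * (n - 1) := by
  induction n with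
  | zero => simp
  | succ n ih => rw [Finset.sum_range_succ, mul_add, ih]; push_cast; ring

theorem sum_range_cast_sq_mul_six (n : ℕ) :
    6 * ∑ j ∈ Finset.range n, (j : ℤ) ^ 2 = n * (n - 1) * (2 * n - 1) := by
  induction n with
  | zero => simp
  | succ n ih => rw [Finset.sum_range_succ, mul_add, ih]; push_cast; ring

theorem layer_sum_le {a : ℕ → ℤ} {n k : ℕ} (hn : n + 2 ≤ k)
    (ha : ∀ j < n, a (j + 1) + 2 ≤ a j) :
    6 * (∑ j ∈ Finset.range (n + 1), (2 * a j * ((j + 1) * (2 * k - 1) - 1) - a j * (a j - 1))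
      - (∑ j ∈ Finset.range (n + 1), a j) * (∑ j ∈ Finset.range (n + 1), a j - 1))
      ≤ 2 * (k ^ 2 * (k + 1) * (k - 1)) := by
  obtain ⟨s, hs⟩ : ∃ s : ℕ → ℤ, ∀ j, a j = k + n - 2 * j - s j :=
    ⟨fun j => k + n - 2 * j - a j, fun j => by ring⟩
  have hmono : MonotoneOn s (Set.Iic n) := by
    intro i hi j hj hij
    rw [Set.mem_Iic] at hj
    induction j, hij using Nat.le_induction with
    | base => exact le_rfl
    | succ m hm ih =>
      have h1 := ha m (by omega)
      have h2 := ih (by omega)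
      rw [hs, hs] at h1
      push_cast at h1
      linarith
  have hquad := centered_quadratic_nonneg hmono (c := 2 * k + 1) (by linarith)
  have h1 := sum_range_cast_mul_two (n + 1)
  have h2 := sum_range_cast_sq_mul_six (n + 1)
  push_cast at h1 h2
  have hN : ∑ j ∈ Finset.range (n + 1), a j
      = (n + 1) * k - ∑ j ∈ Finset.range (n + 1), s j := by
    have : ∑ j ∈ Finset.range (n + 1), a j
        = (n + 1) * (k + n) - 2 * ∑ j ∈ Finset.range (n + 1), (j : ℤ)
          - ∑ j ∈ Finset.range (n + 1), s j := by
      simp only [hs, Finset.sum_sub_distrib, Finset.mul_sum, Finset.sum_const, Finset.card_range]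
      simp
    linear_combination this - h1
  have hF : ∑ j ∈ Finset.range (n + 1),
        (2 * a j * ((j + 1) * (2 * k - 1) - 1) - a j * (a j - 1))
      = (n + 1) * (2 * (k + n) * (2 * k - 2) - (k + n) ^ 2 + (k + n))
        + (2 * (k + n) * (2 * k - 1) - 4 * (2 * k - 2) + 4 * (k + n) - 2)
          * ∑ j ∈ Finset.range (n + 1), (j : ℤ)
        - 8 * k * ∑ j ∈ Finset.range (n + 1), (j : ℤ) ^ 2
        - (2 * k + 1) * ∑ j ∈ Finset.range (n + 1), s j * (2 * j - n)
        - ((2 * k + 1) * n + 4 * k - 3 - 2 * (k + n)) * ∑ j ∈ Finset.range (n + 1), s j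
        - ∑ j ∈ Finset.range (n + 1), s j ^ 2 := by
    have hcst : ((n : ℤ) + 1) * (2 * (k + n) * (2 * k - 2) - (k + n) ^ 2 + (k + n))
        = ∑ _j ∈ Finset.range (n + 1),
          (2 * ((k : ℤ) + n) * (2 * k - 2) - (k + n) ^ 2 + (k + n)) := by simp
    rw [hcst]
    simp only [Finset.mul_sum, ← Finset.sum_add_distrib, ← Finset.sum_sub_distrib]
    refine Finset.sum_congr rfl fun j _ => ?_
    rw [hs]
    ring
  rw [hF, hN]
  generalize ∑ j ∈ Finset.range (n + 1), s j * (2 * j - (n : ℤ)) = C at *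
  generalize ∑ j ∈ Finset.range (n + 1), s j ^ 2 = Q at *
  generalize ∑ j ∈ Finset.range (n + 1), s j = S at *
  obtain ⟨u, rfl⟩ := Nat.exists_eq_add_of_le hn
  generalize ∑ j ∈ Finset.range (n + 1), (j : ℤ) ^ 2 = J₂ at *
  generalize ∑ j ∈ Finset.range (n + 1), (j : ℤ) = J at *
  push_cast at *
  have hpos : 0 ≤ (n + 2 + u : ℤ) * u * (u ^ 2 + 3 * u * (n + 2) + (3 * n + 5)) := by positivity
  linear_combination 6 * hquad + 2 * hpos - 8 * (n + 2 + u) * h2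
    + 3 * (2 * (n + 2 + u + n) * (2 * (n + 2 + u) - 1) - 4 * (2 * (n + 2 + u) - 2)
      + 4 * (n + 2 + u + n) - 2) * h1

theorem two_mul_sum_le_of_forall_le (A : Finset ℕ) (M : ℤ) (hA : ∀ x ∈ A, (x : ℤ) ≤ M) :
    2 * ∑ x ∈ A, (x : ℤ) ≤ 2 * A.card * M - A.card * (A.card - 1) := by
  induction A using Finset.induction_on_max generalizing M with
  | empty => simp
  | insert a A ha ih =>
    have hnot : a ∉ A := fun h => (ha a h).false
    have h1 := ih (a - 1) fun x hx => by
      have := ha x hx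
      omega
    have h2 : (a : ℤ) ≤ M := hA a (Finset.mem_insert_self a A)
    rw [Finset.sum_insert hnot, Finset.card_insert_of_notMem hnot]
    push_cast
    nlinarith

theorem not_mem_Icc_of_sub_mem {X : Finset ℕ} {k : ℕ} (h0 : 0 ∉ X)
    (hX : ∀ t ∈ Finset.Icc (2 * k - 1) (2 * k + 1), ∀ x ∈ X, t ≤ x → x - t ∈ X) (j : ℕ) :
    ∀ x ∈ X, x ∉ Finset.Icc (j * (2 * k - 1)) (j * (2 * k + 1)) := by
  induction j with
  | zero =>
    intro x hx hmem
    simp only [zero_mul, Finset.Icc_self, Finset.mem_singleton] at hmem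
    exact h0 (hmem ▸ hx)
  | succ j ih =>
    intro x hx hmem
    simp only [add_mul, one_mul, Finset.mem_Icc] at hmem
    have hle : j * (2 * k - 1) ≤ j * (2 * k + 1) := Nat.mul_le_mul_left j (by omega)
    obtain ⟨t, ht, htx, h⟩ : ∃ t ∈ Finset.Icc (2 * k - 1) (2 * k + 1), t ≤ x ∧
        x - t ∈ Finset.Icc (j * (2 * k - 1)) (j * (2 * k + 1)) := by
      simp only [Finset.mem_Icc]
      by_cases h1 : x ≤ j * (2 * k + 1) + (2 * k - 1)
      · exact ⟨2 * k - 1, by omega, by omega, by omega⟩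
      · by_cases h2 : x ≤ j * (2 * k + 1) + 2 * k
        · exact ⟨2 * k, by omega, by omega, by omega⟩
        · exact ⟨2 * k + 1, by omega, by omega, by omega⟩
    exact ih _ (hX t ht x hx htx) h

theorem two_mul_sum_sub_le {X : Finset ℕ} {k : ℕ} (hk : 1 ≤ k) (h0 : 0 ∉ X)
    (hX : ∀ t ∈ Finset.Icc (2 * k - 1) (2 * k + 1), ∀ x ∈ X, t ≤ x → x - t ∈ X) :
    6 * (2 * ∑ x ∈ X, (x : ℤ) - X.card * (X.card - 1)) ≤ 2 * (k ^ 2 * (k + 1) * (k - 1)) := by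
  set L : ℕ → Finset ℕ := fun j => X.filter fun x => x / (2 * k - 1) = j with hL
  have hbound : ∀ j, ∀ x ∈ L j, x ∈ X ∧ j * (2 * k + 1) < x ∧ x < (j + 1) * (2 * k - 1) := by
    intro j x hx
    obtain ⟨hxX, rfl⟩ := Finset.mem_filter.1 hx
    have h1 := not_mem_Icc_of_sub_mem h0 hX (x / (2 * k - 1)) x hxX
    have h2 := Nat.div_mul_le_self x (2 * k - 1)
    rw [Finset.mem_Icc] at h1
    exact ⟨hxX, by omega, by
      have := Nat.lt_mul_div_succ x (show 0 < 2 * k - 1 by omega)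
      rwa [mul_comm]⟩
  have hmem : ∀ j, ∀ x ∈ X, j * (2 * k + 1) < x → x < (j + 1) * (2 * k - 1) → x ∈ L j := by
    intro j x hx h1 h2
    refine Finset.mem_filter.2 ⟨hx, ?_⟩
    have hle : j * (2 * k - 1) ≤ j * (2 * k + 1) := Nat.mul_le_mul_left j (by omega)
    exact Nat.div_eq_of_lt_le (by omega) h2
  have hstep : ∀ j, (L (j + 1)).Nonempty → (L (j + 1)).card + 2 ≤ (L j).card := by
    intro j hne
    have hsub : ∀ t ∈ Finset.Icc (2 * k - 1) (2 * k + 1), ∀ x ∈ L (j + 1), x - t ∈ L j := by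
      intro t ht x hx
      obtain ⟨hxX, h1, h2⟩ := hbound _ _ hx
      simp only [add_mul, one_mul] at h1 h2
      have ht' := Finset.mem_Icc.1 ht
      refine hmem _ _ (hX t ht x hxX (by omega)) (by omega) ?_
      simp only [add_mul, one_mul]
      omega
    have hge : ∀ x ∈ L (j + 1), 2 * k + 1 < x := by
      intro x hx
      have h1 := (hbound _ _ hx).2.1
      rw [add_mul, one_mul] at h1
      omega
    set m := (L (j + 1)).max' hne with hm
    have hmL : m ∈ L (j + 1) := Finset.max'_mem _ _
    have hmk := hge m hmL
    have hle : ∀ x ∈ L (j + 1), x ≤ m := fun x hx => Finset.le_max' _ x hx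
    set A := (L (j + 1)).image fun x => x - (2 * k + 1) with hA
    have hAle : ∀ y ∈ A, y ≤ m - (2 * k + 1) := by
      intro y hy
      obtain ⟨x, hx, rfl⟩ := Finset.mem_image.1 hy
      exact Nat.sub_le_sub_right (hle x hx) _
    have hcard : A.card = (L (j + 1)).card := by
      refine Finset.card_image_of_injOn fun x hx y hy h => ?_
      have := hge x hx
      have := hge y hy
      change x - (2 * k + 1) = y - (2 * k + 1) at h
      omega
    have hn1 : m - 2 * k ∉ A := fun h => by
      have := hAle _ h
      omega
    have hn2 : m - (2 * k - 1) ∉ insert (m - 2 * k) A := fun h => by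
      rcases Finset.mem_insert.1 h with h | h
      · omega
      · have := hAle _ h
        omega
    have hins : insert (m - (2 * k - 1)) (insert (m - 2 * k) A) ⊆ L j := by
      intro y hy
      simp only [hA, Finset.mem_insert, Finset.mem_image] at hy
      rcases hy with rfl | rfl | ⟨x, hx, rfl⟩
      · exact hsub _ (Finset.mem_Icc.2 (by omega)) m hmL
      · exact hsub _ (Finset.mem_Icc.2 (by omega)) m hmL
      · exact hsub _ (Finset.mem_Icc.2 (by omega)) x hx
    have := Finset.card_le_card hins
    rw [Finset.card_insert_of_notMem hn2, Finset.card_insert_of_notMem hn1, hcard] at this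
    omega
  have hL0 : (L 0).card ≤ 2 * k - 2 := by
    have hsub : L 0 ⊆ Finset.Icc 1 (2 * k - 2) := fun x hx => by
      have := hbound 0 x hx
      rw [Finset.mem_Icc]
      omega
    simpa using Finset.card_le_card hsub
  have hex : ∃ h, L h = ∅ := by
    by_contra! hne
    have hgrow : ∀ j, (L j).card + 2 * j ≤ (L 0).card := by
      intro j
      induction j with
      | zero => simp
      | succ j ih =>
        have := hstep j (hne (j + 1))
        omega
    have := hgrow k
    omega
  obtain ⟨h, hh, hmin⟩ : ∃ h, L h = ∅ ∧ ∀ j < h, (L j).Nonempty :=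
    ⟨Nat.find hex, Nat.find_spec hex, fun j hj =>
      Finset.nonempty_iff_ne_empty.2 (Nat.find_min hex hj)⟩
  have hempty : ∀ j, h ≤ j → L j = ∅ := by
    intro j hj
    induction j, hj using Nat.le_induction with
    | base => exact hh
    | succ j hj ih =>
      by_contra hne
      have := hstep j (Finset.nonempty_iff_ne_empty.2 hne)
      simp [ih] at this
  have hmaps : ∀ x ∈ X, x / (2 * k - 1) ∈ Finset.range h := by
    intro x hx
    rw [Finset.mem_range]
    by_contra! hle
    have : x ∈ L (x / (2 * k - 1)) := Finset.mem_filter.2 ⟨hx, rfl⟩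
    simp [hempty _ hle] at this
  have hcard : (X.card : ℤ) = ∑ j ∈ Finset.range h, ((L j).card : ℤ) := by
    exact_mod_cast Finset.card_eq_sum_card_fiberwise hmaps
  have hsum : 2 * ∑ x ∈ X, (x : ℤ) ≤ ∑ j ∈ Finset.range h,
      (2 * ((L j).card : ℤ) * ((j + 1) * (2 * k - 1) - 1)
        - (L j).card * ((L j).card - 1)) := by
    rw [← Finset.sum_fiberwise_of_maps_to hmaps, Finset.mul_sum]
    refine Finset.sum_le_sum fun j _ => two_mul_sum_le_of_forall_le (L j) _ fun x hx => ?_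
    have h1 := (hbound j x hx).2.2
    have h2 : (x : ℤ) < (j + 1) * ((2 * k - 1 : ℕ) : ℤ) := by exact_mod_cast h1
    rw [Nat.cast_sub (by omega)] at h2
    push_cast at h2
    linarith
  rcases h with _ | n
  · simp only [Finset.range_zero, Finset.sum_empty] at hsum hcard
    have hk' : (1 : ℤ) ≤ k := by exact_mod_cast hk
    have : (0 : ℤ) ≤ k ^ 2 * (k + 1) * (k - 1) :=
      mul_nonneg (by positivity) (by linarith)
    rw [hcard]
    linarith
  · have hgrow : ∀ j < n + 1, (L j).card + 2 * j ≤ (L 0).card := by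
      intro j hj
      induction j with
      | zero => simp
      | succ j ih =>
        have := hstep j (hmin (j + 1) hj)
        have := ih (by omega)
        omega
    have hn := hgrow n (by omega)
    have hnpos := (hmin n (by omega)).card_pos
    have key := layer_sum_le (a := fun j => ((L j).card : ℤ)) (n := n) (k := k) (by omega)
      fun j hj => by exact_mod_cast hstep j (hmin (j + 1) (by omega))
    simp only [← hcard] at key
    linarith

/-- The Young diagram whose column `j` has `(k - 1 - √j) * (k - √j)` cells. -/
def squareCore (k : ℕ) : YoungDiagram where
  cells := (Finset.range (k ^ 2) ×ˢ Finset.range (k ^ 2)).filter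
    (fun c => c.1 < (k - 1 - c.2.sqrt) * (k - c.2.sqrt))
  isLowerSet := by
    rintro ⟨i, j⟩ ⟨i', j'⟩ ⟨hi, hj⟩ hmem
    simp only [Finset.coe_filter, Finset.mem_product, Finset.mem_range, Set.mem_ofPred_eq] at *
    have h := Nat.sqrt_le_sqrt hj
    refine ⟨⟨by omega, by omega⟩, lt_of_le_of_lt hi (hmem.2.trans_le ?_)⟩
    exact Nat.mul_le_mul (by omega) (by omega)

theorem mem_squareCore {k i j : ℕ} :
    (i, j) ∈ squareCore k ↔ i < (k - 1 - j.sqrt) * (k - j.sqrt) := by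
  rw [← YoungDiagram.mem_cells]
  simp only [squareCore, Finset.mem_filter, Finset.mem_product, Finset.mem_range,
    and_iff_right_iff_imp]
  intro h
  have hlt : j.sqrt < k := by
    by_contra! hle
    simp [Nat.sub_eq_zero_of_le hle] at h
  refine ⟨h.trans_le ?_, Nat.sqrt_lt'.1 hlt⟩
  rw [sq]
  exact Nat.mul_le_mul (by omega) (by omega)

theorem colLen_squareCore (k j : ℕ) :
    (squareCore k).colLen j = (k - 1 - j.sqrt) * (k - j.sqrt) :=
  eq_of_forall_lt_iff fun _ => YoungDiagram.mem_iff_lt_colLen.symm.trans mem_squareCore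

theorem rowLen_squareCore {k i u : ℕ} (hu : u ≤ k) (h1 : (u - 1) * u ≤ i)
    (h2 : i < u * (u + 1)) : (squareCore k).rowLen i = (k - u) ^ 2 := by
  refine eq_of_forall_lt_iff fun j => YoungDiagram.mem_iff_lt_rowLen.symm.trans ?_
  rw [mem_squareCore, ← Nat.sqrt_lt']
  constructor
  · intro h
    by_contra! hle
    have : (k - 1 - j.sqrt) * (k - j.sqrt) ≤ (u - 1) * u :=
      Nat.mul_le_mul (by omega) (by omega)
    omega
  · intro h
    exact h2.trans_le (Nat.mul_le_mul (by omega) (by omega))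

theorem isCore_squareCore {k t : ℕ} (ht : t ∈ Finset.Icc (2 * k - 1) (2 * k + 1)) :
    (squareCore k).IsCore t := by
  rintro ⟨i, j⟩ hmem hhook
  rw [YoungDiagram.mem_cells] at hmem
  have hi := mem_squareCore.1 hmem
  have hj := YoungDiagram.mem_iff_lt_rowLen.1 hmem
  obtain ⟨u, hu1, hu2⟩ : ∃ u, (u - 1) * u ≤ i ∧ i < u * (u + 1) := by
    have hex : ∃ u, i < u * (u + 1) := ⟨i + 1, by nlinarith⟩
    refine ⟨Nat.find hex, ?_, Nat.find_spec hex⟩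
    by_contra! h
    rcases Nat.eq_zero_or_pos (Nat.find hex) with h0 | h0
    · simp [h0] at h
    · refine Nat.find_min hex (m := Nat.find hex - 1) (by omega) ?_
      rwa [Nat.sub_add_cancel h0]
  set p := j.sqrt with hp
  have hp1 : p * p ≤ j := Nat.sqrt_le j
  have hp2 : j ≤ p * p + p + p := Nat.sqrt_le_add j
  have hup : u + p + 1 ≤ k := by
    by_contra! h
    have : (k - 1 - p) * (k - p) ≤ (u - 1) * u := Nat.mul_le_mul (by omega) (by omega)
    omega
  obtain ⟨w, rfl⟩ := Nat.exists_eq_add_of_le hup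
  rw [rowLen_squareCore (by omega) hu1 hu2] at hj
  simp only [YoungDiagram.hookLength, colLen_squareCore,
    rowLen_squareCore (show u ≤ u + p + 1 + w by omega) hu1 hu2, ← hp] at hhook
  rw [show u + p + 1 + w - u = p + 1 + w by omega] at hj hhook
  rw [show u + p + 1 + w - 1 - p = u + w by omega,
    show u + p + 1 + w - p = u + w + 1 by omega] at hi hhook
  rw [Finset.mem_Icc] at ht
  have hu1' : (u : ℤ) * u - u ≤ i := by
    rcases u with _ | v
    · simp
    · push_cast
      have : (v * (v + 1) : ℤ) ≤ i := by exact_mod_cast hu1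
      linarith
  have heq : ((p + 1 + w : ℤ)) ^ 2 - j + ((u + w) * (u + w + 1) - i) - 1 = t := by
    have e1 : (((p + 1 + w) ^ 2 - j : ℕ) : ℤ) = (p + 1 + w : ℤ) ^ 2 - j := by
      rw [Nat.cast_sub hj.le]; push_cast; rfl
    have e2 : (((u + w) * (u + w + 1) - i : ℕ) : ℤ) = (u + w : ℤ) * (u + w + 1) - i := by
      rw [Nat.cast_sub hi.le]; push_cast; rfl
    rw [← e1, ← e2]
    omega
  have ht1 : (2 * (u + p + 1 + w) - 1 : ℤ) ≤ t := by omega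
  have ht2 : (t : ℤ) ≤ 2 * (u + p + 1 + w) + 1 := by omega
  zify at hu2 hp1 hp2
  rcases w with _ | w
  · push_cast at *
    nlinarith
  · push_cast at *
    nlinarith [mul_nonneg (Int.natCast_nonneg w) (Int.natCast_nonneg u),
      mul_nonneg (Int.natCast_nonneg w) (Int.natCast_nonneg p), sq_nonneg (w : ℤ)]

theorem sum_range_sq_sqrt (f : ℕ → ℕ) (n : ℕ) :
    ∑ j ∈ Finset.range (n ^ 2), f j.sqrt = ∑ p ∈ Finset.range n, (2 * p + 1) * f p := by
  induction n with
  | zero => simp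
  | succ n ih =>
    rw [Finset.sum_range_succ, ← ih, show (n + 1) ^ 2 = n ^ 2 + (2 * n + 1) by ring,
      Finset.sum_range_add]
    congr 1
    rw [Finset.sum_congr rfl (g := fun _ => f n), Finset.sum_const, Finset.card_range, smul_eq_mul]
    intro e he
    have := Finset.mem_range.1 he
    congr 1
    rw [sq]
    exact Nat.sqrt_add_eq n (by omega)

theorem card_squareCore (k : ℕ) :
    6 * ((squareCore k).card : ℤ) = k ^ 2 * (k + 1) * (k - 1) := by
  have hcard : (squareCore k).card
      = ∑ p ∈ Finset.range k, (2 * p + 1) * ((k - 1 - p) * (k - p)) := by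
    have hmaps : ∀ c ∈ (squareCore k).cells, c.2 ∈ Finset.range (k ^ 2) := fun c hc => by
      simp only [squareCore, Finset.mem_filter, Finset.mem_product] at hc
      exact hc.1.2
    rw [YoungDiagram.card, Finset.card_eq_sum_card_fiberwise hmaps,
      ← sum_range_sq_sqrt fun p => (k - 1 - p) * (k - p)]
    refine Finset.sum_congr rfl fun j _ => ?_
    rw [← colLen_squareCore, YoungDiagram.colLen_eq_card]
    rfl
  have hpoly : ∀ n : ℕ, 6 * ∑ p ∈ Finset.range n, (2 * p + 1) * ((k - 1 - p) * (k - p) : ℤ)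
      = 3 * n ^ 2 * (n - 1) ^ 2 + (3 - 4 * k) * n * (n - 1) * (2 * n - 1)
        + 3 * (2 * k ^ 2 - 4 * k + 1) * n * (n - 1) + 6 * k * (k - 1) * n := by
    intro n
    induction n with
    | zero => simp
    | succ n ih => rw [Finset.sum_range_succ, mul_add, ih]; push_cast; ring
  have hcast : ((squareCore k).card : ℤ)
      = ∑ p ∈ Finset.range k, (2 * p + 1) * ((k - 1 - p) * (k - p) : ℤ) := by
    rw [hcard]
    push_cast
    refine Finset.sum_congr rfl fun p hp => ?_
    have := Finset.mem_range.1 hp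
    rw [Nat.cast_sub (by omega : p ≤ k - 1), Nat.cast_sub (by omega : p ≤ k),
      Nat.cast_sub (by omega : 1 ≤ k)]
    push_cast
    ring
  rw [hcast, hpoly]
  ring

theorem six_mul_choose_three (k : ℕ) :
    6 * ((k + 1).choose 3 : ℤ) = (k + 1) * k * (k - 1) := by
  rcases k with _ | k
  · simp [Nat.choose_eq_zero_of_lt]
  · have h := Nat.add_one_mul_choose_eq (k + 1) 2
    have h3 : (k + 1).choose 2 * 2 = (k + 1) * k := by
      rw [Nat.choose_two_right]
      simpa using Nat.div_mul_cancel (Nat.even_mul_pred_self (k + 1)).two_dvd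
    zify at h h3
    push_cast
    linear_combination (-2) * h + (k + 2 : ℤ) * h3

theorem max_size_three_cores (k : ℕ) (hk : 1 ≤ k) :
    IsGreatest {n : ℕ | ∃ Y : YoungDiagram,
        Y.IsCore (2 * k - 1) ∧ Y.IsCore (2 * k) ∧ Y.IsCore (2 * k + 1) ∧ Y.card = n}
      (k * (k + 1).choose 3) ∧
    k * (k + 1).choose 3 = k ^ 2 * (k + 1) * (k - 1) / 6 := by
  have hchoose : 6 * (k * (k + 1).choose 3 : ℤ) = k ^ 2 * (k + 1) * (k - 1) := by
    linear_combination (k : ℤ) * six_mul_choose_three k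
  refine ⟨⟨⟨squareCore k, ?_, ?_, ?_, ?_⟩, ?_⟩, ?_⟩
  · exact isCore_squareCore (Finset.mem_Icc.2 (by omega))
  · exact isCore_squareCore (Finset.mem_Icc.2 (by omega))
  · exact isCore_squareCore (Finset.mem_Icc.2 (by omega))
  · have h := card_squareCore k
    zify
    linarith
  · rintro n ⟨Y, h1, h2, h3, rfl⟩
    have hX : ∀ t ∈ Finset.Icc (2 * k - 1) (2 * k + 1), ∀ x ∈ Y.betaSet_s2, t ≤ x →
        x - t ∈ Y.betaSet_s2 := by
      intro t ht x hx htx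
      rw [Finset.mem_Icc] at ht
      have hY : Y.IsCore t := by
        obtain rfl | rfl | rfl : t = 2 * k - 1 ∨ t = 2 * k ∨ t = 2 * k + 1 := by omega
        · exact h1
        · exact h2
        · exact h3
      exact hY.sub_mem_betaSet (by omega) hx htx
    have hle := two_mul_sum_sub_le hk Y.zero_notMem_betaSet hX
    have hsum : 2 * ∑ x ∈ Y.betaSet_s2, (x : ℤ)
        = 2 * Y.card + Y.betaSet_s2.card * (Y.betaSet_s2.card - 1) := by
      have h := congrArg (Nat.cast : ℕ → ℤ) Y.two_mul_sum_betaSet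
      rcases hm : Y.betaSet_s2.card with _ | m
      · rw [hm] at h
        simpa using h
      · rw [hm] at h
        simpa using h
    zify
    linarith
  · refine (Nat.div_eq_of_eq_mul_right (by norm_num) ?_).symm
    zify [hk]
    linear_combination -hchoose
end

section
/- For every integer k ≥ 2, the partition whose beta-set (set of first-column hook lengths) is S(k) = {2kj + c : 0 ≤ j ≤ k−2, j+1 ≤ c ≤ 2k−2−j} has multiset of parts consisting of exactly the squares i², where i² occurs with multiplicity 2k − 2i for each i = 1, 2, …, k−1; that is, this partition equals ({(k−1)²}², {(k−2)²}⁴, …, 9^{2k−6}, 4^{2k−4}, 1^{2k−2}) in exponential notation. -/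
/-- The beta-set (set of first-column hook lengths) of a Young diagram. -/
def YoungDiagram.betaSet (Y : YoungDiagram) : Finset ℕ :=
  (Finset.range (Y.colLen 0)).image fun i => Y.hookLength i 0

/-- The set `S(k) = {2kj + c : 0 ≤ j ≤ k−2, j+1 ≤ c ≤ 2k−2−j}`. -/
def S (k : ℕ) : Finset ℕ :=
  (Finset.range (k - 1)).biUnion fun j =>
    (Finset.Icc (j + 1) (2 * k - 2 - j)).image fun c => 2 * k * j + c

/-- The beta-set of a list of parts, by recursion on the list. -/
def listBetaSet : List ℕ → Finset ℕ
  | [] => ∅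
  | a :: w => insert (a + w.length) (listBetaSet w)

theorem listBetaSet_eq_image (w : List ℕ) :
    listBetaSet w = (Finset.range w.length).image fun i => w.getD i 0 + (w.length - i) - 1 := by
  induction w with
  | nil => simp [listBetaSet]
  | cons a w ih =>
    rw [listBetaSet, ih, List.length_cons, Finset.range_add_one', Finset.image_insert,
      Finset.map_eq_image, Finset.image_image]
    congr 1
    refine Finset.image_congr fun i _ => ?_
    change _ = (a :: w).getD (i + 1) 0 + (w.length + 1 - (i + 1)) - 1
    simp

theorem YoungDiagram.betaSet_eq_listBetaSet (Y : YoungDiagram) :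
    Y.betaSet = listBetaSet Y.rowLens := by
  rw [listBetaSet_eq_image, YoungDiagram.betaSet, YoungDiagram.length_rowLens]
  refine Finset.image_congr fun i hi => ?_
  have hi' : i < Y.rowLens.length := by simpa using hi
  rw [List.getD_eq_getElem _ _ hi', YoungDiagram.get_rowLens, YoungDiagram.hookLength, Nat.sub_zero]

theorem listBetaSet_replicate_append (c a : ℕ) (w : List ℕ) :
    listBetaSet (List.replicate c a ++ w) =
      ((Finset.range c).image fun r => a + w.length + r) ∪ listBetaSet w := by
  induction c with
  | zero => simp
  | succ c ih =>
    rw [List.replicate_succ, List.cons_append, listBetaSet, ih, Finset.range_add_one,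
      Finset.image_insert, Finset.insert_union]
    congr 1
    simp
    ring

/-- The weakly decreasing list in which `(i + 1) ^ 2` occurs `2 * k - 2 * (i + 1)` times
for each `i < n`. -/
def squareParts (k : ℕ) : ℕ → List ℕ
  | 0 => []
  | n + 1 => List.replicate (2 * k - 2 * (n + 1)) ((n + 1) ^ 2) ++ squareParts k n

theorem mem_squareParts {k n x : ℕ} (hx : x ∈ squareParts k n) : 0 < x ∧ x ≤ n ^ 2 := by
  induction n with
  | zero => simp [squareParts] at hx
  | succ n ih =>
    rcases List.mem_append.1 hx with h | h
    · rw [List.eq_of_mem_replicate h]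
      exact ⟨by positivity, le_rfl⟩
    · exact ⟨(ih h).1, (ih h).2.trans (Nat.pow_le_pow_left n.le_succ 2)⟩

theorem sortedGE_squareParts (k n : ℕ) : (squareParts k n).SortedGE := by
  rw [List.sortedGE_iff_pairwise]
  induction n with
  | zero => simp [squareParts]
  | succ n ih =>
    rw [squareParts, List.pairwise_append]
    refine ⟨List.pairwise_replicate.2 (Or.inr le_rfl), ih, fun a ha b hb => ?_⟩
    rw [List.eq_of_mem_replicate ha]
    exact (mem_squareParts hb).2.trans (Nat.pow_le_pow_left n.le_succ 2)

theorem length_squareParts {k n : ℕ} (hn : n < k) :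
    (squareParts k n).length + n * (n + 1) = 2 * k * n := by
  induction n with
  | zero => simp [squareParts]
  | succ n ih =>
    have := ih (by omega)
    obtain ⟨d, rfl⟩ := Nat.exists_eq_add_of_lt hn
    rw [squareParts, List.length_append, List.length_replicate,
      show 2 * (n + 1 + d + 1) - 2 * (n + 1) = 2 * (d + 1) by omega]
    linarith

theorem coe_squareParts (k n : ℕ) :
    (squareParts k n : Multiset ℕ) =
      (Multiset.range n).bind fun i => Multiset.replicate (2 * k - 2 * (i + 1)) ((i + 1) ^ 2) := by
  induction n with
  | zero => simp [squareParts]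
  | succ n ih =>
    rw [squareParts, Multiset.range_succ, Multiset.cons_bind, ← ih, ← Multiset.coe_add,
      Multiset.coe_replicate]

theorem listBetaSet_squareParts {k n : ℕ} (hn : n < k) :
    listBetaSet (squareParts k n) = (Finset.range n).biUnion fun j =>
      (Finset.Icc (j + 1) (2 * k - 2 - j)).image fun c => 2 * k * j + c := by
  induction n with
  | zero => simp [squareParts, listBetaSet]
  | succ n ih =>
    have hlen := length_squareParts (k := k) (n := n) (by omega)
    rw [squareParts, listBetaSet_replicate_append, ih (by omega), Finset.range_add_one (n := n),
      Finset.biUnion_insert]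
    congr 1
    have hsq : (n + 1) ^ 2 + (squareParts k n).length = 2 * k * n + (n + 1) := by linarith
    ext x
    simp only [Finset.mem_image, Finset.mem_range, Finset.mem_Icc, hsq]
    constructor
    · rintro ⟨r, hr, rfl⟩
      exact ⟨n + 1 + r, by omega, by omega⟩
    · rintro ⟨c, hc, rfl⟩
      exact ⟨c - (n + 1), by omega, by omega⟩

theorem betaSet_partition_parts (k : ℕ) (hk : 2 ≤ k) :
    ∃ Y : YoungDiagram, Y.betaSet = S k ∧
      (Y.rowLens : Multiset ℕ) =
        (Multiset.range (k - 1)).bind fun i =>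
          Multiset.replicate (2 * k - 2 * (i + 1)) ((i + 1) ^ 2) := by
  have hrow := YoungDiagram.rowLens_ofRowLens_eq_self
    (hw := sortedGE_squareParts k (k - 1)) fun x hx => (mem_squareParts hx).1
  refine ⟨YoungDiagram.ofRowLens _ (sortedGE_squareParts k (k - 1)), ?_, ?_⟩
  · rw [YoungDiagram.betaSet_eq_listBetaSet, hrow, listBetaSet_squareParts (by omega), S]
  · rw [hrow, coe_squareParts]
end
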